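/- For every real number t with 0 ≤ t < ∞ and every sequence a : ℕ → ℕ with a(n) ≥ 2 for all n, there exists an uncountable family of Toeplitz flows (Xᵢ, Tᵢ), i ∈ I (each the orbit closure of a nonperiodic Toeplitz sequence over a finite alphabet), such that: each Tᵢ has topological entropy t; for every i the set of continuous eigenvalues of Tᵢ — the λ ∈ ℂ for which there is a continuous f : Xᵢ → ℂ, not identically zero, with f∘Tᵢ = λ·f — equals {e^{2πi·m/(a(0)·a(1)⋯a(k))} : m ∈ ℤ, k ∈ ℕ}; and for all i ≠ j the systems (Xᵢ, Tᵢ) and (Xⱼ, Tⱼ) are not strong orbit equivalent. -/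

import Mathlib

/-- A Toeplitz sequence: every position is periodic for some period `p ≥ 1`. -/
def IsToeplitz {Λ : Type*} (η : ℤ → Λ) : Prop :=
  ∀ n : ℤ, ∃ p : ℤ, 1 ≤ p ∧ ∀ m : ℤ, η (n + m * p) = η n

/-- A sequence is nonperiodic if it has no global period `p ≥ 1`. -/
def IsNonperiodic {Λ : Type*} (η : ℤ → Λ) : Prop :=
  ¬ ∃ p : ℤ, 1 ≤ p ∧ ∀ n : ℤ, η (n + p) = η n

/-- The two-sided shift orbit of `η` in `Λ^ℤ`. -/
def shiftOrbit {Λ : Type*} (η : ℤ → Λ) : Set (ℤ → Λ) :=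
  {x | ∃ n : ℤ, x = fun k => η (k + n)}

/-- The shift homeomorphism on `Λ^ℤ`. -/
def shiftHomeo (Λ : Type*) [TopologicalSpace Λ] : (ℤ → Λ) ≃ₜ (ℤ → Λ) where
  toFun x := fun k => x (k + 1)
  invFun x := fun k => x (k - 1)
  left_inv x := by funext k; simp
  right_inv x := by funext k; simp
  continuous_toFun := continuous_pi fun k => continuous_apply (k + 1)
  continuous_invFun := continuous_pi fun k => continuous_apply (k - 1)

/-- The phase space of the Toeplitz flow of `η`: the orbit closure of `η`. -/
def toeplitzX {Λ : Type*} [TopologicalSpace Λ] (η : ℤ → Λ) : Set (ℤ → Λ) :=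
  closure (shiftOrbit η)

lemma shiftHomeo_image_orbit {Λ : Type*} [TopologicalSpace Λ] (η : ℤ → Λ) :
    shiftHomeo Λ '' shiftOrbit η = shiftOrbit η := by
  ext x
  constructor
  · rintro ⟨y, ⟨n, rfl⟩, rfl⟩
    exact ⟨n + 1, by funext k; show η (k + 1 + n) = η (k + (n + 1)); ring_nf⟩
  · rintro ⟨n, rfl⟩
    refine ⟨fun k => η (k + (n - 1)), ⟨n - 1, rfl⟩, ?_⟩
    funext k; show η (k + 1 + (n - 1)) = η (k + n); ring_nf

lemma shiftHomeo_image_toeplitzX {Λ : Type*} [TopologicalSpace Λ] (η : ℤ → Λ) :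
    shiftHomeo Λ '' toeplitzX η = toeplitzX η := by
  rw [toeplitzX, Homeomorph.image_closure, shiftHomeo_image_orbit]

/-- The Toeplitz flow transformation: the shift restricted to the orbit
closure of `η`. -/
def toeplitzT {Λ : Type*} [TopologicalSpace Λ] (η : ℤ → Λ) :
    ↥(toeplitzX η) ≃ₜ ↥(toeplitzX η) :=
  ((shiftHomeo Λ).image (toeplitzX η)).trans
    (Homeomorph.setCongr (shiftHomeo_image_toeplitzX η))

/-- A Toeplitz flow: a nonperiodic Toeplitz sequence over a finite nonempty
alphabet (with the discrete uniformity/topology), together with the orbit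
closure dynamics. -/
structure ToeplitzFlow : Type 1 where
  Λ : Type
  [fin : Fintype Λ]
  [nonempty : Nonempty Λ]
  η : ℤ → Λ
  toeplitz : IsToeplitz η
  nonperiodic : IsNonperiodic η

attribute [instance] ToeplitzFlow.fin ToeplitzFlow.nonempty

noncomputable instance (F : ToeplitzFlow) : UniformSpace F.Λ := ⊥

instance (F : ToeplitzFlow) : DiscreteTopology F.Λ := by
  constructor
  change UniformSpace.toTopologicalSpace = ⊥
  exact UniformSpace.toTopologicalSpace_bot

/-- The phase space of a Toeplitz flow. -/
abbrev ToeplitzFlow.X (F : ToeplitzFlow) : Type := ↥(toeplitzX F.η)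

/-- The transformation of a Toeplitz flow (the restricted shift). -/
noncomputable def ToeplitzFlow.T (F : ToeplitzFlow) : F.X ≃ₜ F.X := toeplitzT F.η

/-- The topological entropy (Bowen–Dinaburg cover entropy, with respect to the
canonical uniformity of the compact metrizable space `F.X`) of a Toeplitz flow. -/
noncomputable def ToeplitzFlow.entropy (F : ToeplitzFlow) : EReal :=
  Dynamics.coverEntropy (F.T : F.X → F.X) Set.univ

/-- The full (two-sided) orbit of `x` under the homeomorphism `T`. -/
def homeoOrbit {X : Type*} [TopologicalSpace X] (T : X ≃ₜ X) (x : X) : Set X :=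
  Set.range fun n : ℤ => (T.toEquiv ^ n) x

/-- Strong orbit equivalence: an orbit equivalence whose two orbit cocycles
each have at most one point of discontinuity. -/
def StrongOrbitEquiv {X Y : Type*} [TopologicalSpace X] [TopologicalSpace Y]
    (T : X ≃ₜ X) (S : Y ≃ₜ Y) : Prop :=
  ∃ e : X ≃ₜ Y,
    (∀ x : X, e '' homeoOrbit T x = homeoOrbit S (e x)) ∧
    ∃ n m : X → ℤ,
      (∀ x : X, e (T x) = (S.toEquiv ^ n x) (e x)) ∧
      (∀ x : X, e ((T.toEquiv ^ m x) x) = S (e x)) ∧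
      {x : X | ¬ ContinuousAt n x}.Subsingleton ∧
      {x : X | ¬ ContinuousAt m x}.Subsingleton

/-- The subgroup of integer-valued continuous coboundaries of a homeomorphism. -/
def intCoboundaries {X : Type*} [TopologicalSpace X] (T : X ≃ₜ X) : AddSubgroup C(X, ℤ) where
  carrier := {f | ∃ g : C(X, ℤ), ∀ x, f x = g (T x) - g x}
  zero_mem' := ⟨0, by simp⟩
  add_mem' := by
    rintro _ _ ⟨g, hg⟩ ⟨g', hg'⟩
    exact ⟨g + g', fun x => by simp [hg, hg']; ring⟩
  neg_mem' := by
    rintro _ ⟨g, hg⟩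
    exact ⟨-g, fun x => by simp [hg]; ring⟩

lemma continuous_toEquiv_zpow {X : Type*} [TopologicalSpace X] (T : X ≃ₜ X) (k : ℤ) :
    Continuous (T.toEquiv ^ k : Equiv.Perm X) := by
  induction k using Int.induction_on with
  | zero => simpa using continuous_id
  | succ k ih =>
    rw [zpow_add_one]
    exact ih.comp T.continuous
  | pred k ih =>
    rw [zpow_sub_one]
    exact ih.comp T.symm.continuous

/-- The integer-valued function `x ↦ f (T ^ k x)`. -/
def compZPow {X : Type*} [TopologicalSpace X] (T : X ≃ₜ X) (f : C(X, ℤ)) (k : ℤ) : C(X, ℤ) :=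
  ⟨fun x => f ((T.toEquiv ^ k : Equiv.Perm X) x), f.continuous.comp (continuous_toEquiv_zpow T k)⟩

lemma compZPow_sub_mem_intCoboundaries {X : Type*} [TopologicalSpace X] (T : X ≃ₜ X)
    (f : C(X, ℤ)) (k : ℤ) : compZPow T f k - f ∈ intCoboundaries T := by
  induction k using Int.induction_on with
  | zero =>
    convert (intCoboundaries T).zero_mem using 1
    ext x; simp [compZPow]
  | succ k ih =>
    have h : compZPow T f (k + 1) - compZPow T f k ∈ intCoboundaries T :=
      ⟨compZPow T f k, fun x => by simp [compZPow, zpow_add_one]⟩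
    simpa using (intCoboundaries T).add_mem h ih
  | pred k ih =>
    have h : compZPow T f (-k) - compZPow T f (-k - 1) ∈ intCoboundaries T :=
      ⟨compZPow T f (-k - 1), fun x => by
        simp only [compZPow, ContinuousMap.coe_sub, ContinuousMap.coe_mk, Pi.sub_apply,
          zpow_sub_one, Equiv.Perm.mul_apply]
        simp⟩
    have := (intCoboundaries T).sub_mem ih h
    simpa using this

/-- If `S` is conjugate to `x ↦ T ^ (m x) x` with `m` continuous off one point, then coboundaries of
`S` pull back to coboundaries of `T`. -/
lemma exists_coboundary_comp {X Y : Type*} [TopologicalSpace X] [CompactSpace X]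
    [TopologicalSpace Y] (T : X ≃ₜ X) (S : Y ≃ₜ Y) (e : X ≃ₜ Y) (m : X → ℤ)
    (hm : ∀ x, e ((T.toEquiv ^ m x : Equiv.Perm X) x) = S (e x))
    (hc : {x : X | ¬ ContinuousAt m x}.Subsingleton) (g : C(Y, ℤ)) :
    ∃ g' : C(X, ℤ), ∀ x, g (S (e x)) - g (e x) = g' (T x) - g' x := by
  classical
  rcases isEmpty_or_nonempty X with hX | hX
  · exact ⟨0, fun x => (hX.false x).elim⟩
  obtain ⟨x₀, hx₀⟩ : ∃ x₀, ∀ x, x ≠ x₀ → ContinuousAt m x := by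
    by_cases h : ∃ x₀, ¬ ContinuousAt m x₀
    · obtain ⟨x₀, h⟩ := h
      refine ⟨x₀, fun x hx => ?_⟩
      by_contra hx'
      exact hx (hc hx' h)
    · push Not at h
      exact ⟨Classical.arbitrary X, fun x _ => h x⟩
  -- normalise so that the transported function vanishes near the bad point
  set G : C(X, ℤ) := ⟨fun x => g (e x) - g (S (e x₀)), by fun_prop⟩ with hG
  let R : X ≃ₜ X := (e.trans S).trans e.symm
  have hR : ∀ x, (T.toEquiv ^ m x : Equiv.Perm X) x = R x := fun x => by
    apply e.injective; simp [R, hm]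
  have hGR : Continuous fun x => G (R x) := G.continuous.comp R.continuous
  have hG0 : G (R x₀) = 0 := by simp [hG, R]
  set B : Set X := {x | G (R x) ≠ 0} with hB
  have hBclosed : IsClosed B := (isClosed_discrete ({0}ᶜ : Set ℤ)).preimage hGR
  have hmB : ∀ x ∈ B, ContinuousAt m x := fun x hx => hx₀ x fun h => hx (h ▸ hG0)
  have hfin : (m '' B).Finite :=
    (hBclosed.isCompact.image_of_continuousOn
      fun x hx => (hmB x hx).continuousWithinAt).finite_of_discrete
  have hcont : ∀ k : ℤ, Continuous fun x => if m x = k then G (R x) else 0 := by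
    intro k
    rw [continuous_iff_continuousAt]
    intro x
    by_cases hx : G (R x) = 0
    · have : ∀ᶠ y in nhds x, G (R y) = 0 :=
        hGR.continuousAt.eventually_mem ((isOpen_discrete {0}).mem_nhds hx)
      refine (continuousAt_const (y := (0 : ℤ))).congr ?_
      filter_upwards [this] with y hy
      simp [hy]
    · have h1 : ∀ᶠ y in nhds x, m y = m x :=
        (hmB x hx).eventually_mem ((isOpen_discrete {m x}).mem_nhds rfl)
      by_cases hk : m x = k
      · refine hGR.continuousAt.congr ?_
        filter_upwards [h1] with y hy
        simp [hy, hk]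
      · refine (continuousAt_const (y := (0 : ℤ))).congr ?_
        filter_upwards [h1] with y hy
        simp [hy, hk]
  let P : ℤ → C(X, ℤ) := fun k => ⟨_, hcont k⟩
  have hsum : ∀ x, G (R x) = ∑ k ∈ hfin.toFinset, P k x := by
    intro x
    simp only [P, ContinuousMap.coe_mk]
    rw [Finset.sum_ite_eq]
    split_ifs with h
    · rfl
    · by_contra h'
      exact h (hfin.mem_toFinset.2 ⟨x, h', rfl⟩)
  have hinv : ∀ k x, P k (R.symm x) = compZPow T (P k) (-k) x := by
    intro k x
    simp only [P, compZPow, ContinuousMap.coe_mk]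
    by_cases h1 : m (R.symm x) = k
    · have h2 : (T.toEquiv ^ (-k) : Equiv.Perm X) x = R.symm x := by
        have := hR (R.symm x)
        rw [h1, R.apply_symm_apply] at this
        rw [zpow_neg, Equiv.Perm.inv_eq_iff_eq, this]
      rw [h2]
    · rw [if_neg h1]
      by_cases h3 : m ((T.toEquiv ^ (-k) : Equiv.Perm X) x) = k
      · exfalso
        have := hR ((T.toEquiv ^ (-k) : Equiv.Perm X) x)
        rw [h3, ← Equiv.Perm.mul_apply, ← zpow_add, add_neg_cancel, zpow_zero,
          Equiv.Perm.one_apply] at this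
        apply h1
        rw [this, R.symm_apply_apply, h3]
      · rw [if_neg h3]
  have hmem : ∑ k ∈ hfin.toFinset, (P k - compZPow T (P k) (-k)) ∈ intCoboundaries T :=
    sum_mem fun k _ => by
      rw [← neg_sub]
      exact neg_mem (compZPow_sub_mem_intCoboundaries T (P k) (-k))
  obtain ⟨g', hg'⟩ := hmem
  refine ⟨g', fun x => ?_⟩
  rw [← hg' x]
  have h1 := hsum x
  have h2 := hsum (R.symm x)
  rw [R.apply_symm_apply] at h2
  simp_rw [hinv] at h2
  simp only [ContinuousMap.coe_sum, ContinuousMap.coe_sub, Finset.sum_apply, Pi.sub_apply,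
    Finset.sum_sub_distrib]
  rw [← h1, ← h2]
  simp [hG, R]

/-- The real numbers occurring as the uniform average of some continuous integer-valued function,
expressed through coboundaries. -/
def cohomologicalAverages {X : Type*} [TopologicalSpace X] (T : X ≃ₜ X) : Set ℝ :=
  {r | ∃ f : C(X, ℤ), ∀ ε > (0 : ℝ), ∃ N : ℕ, 0 < N ∧ ∃ g : C(X, ℤ),
    ∀ x, |((N * f x + (g (T x) - g x) : ℤ) : ℝ) - N * r| ≤ N * ε}

lemma cohomologicalAverages_subset {X Y : Type*} [TopologicalSpace X] [CompactSpace X]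
    [TopologicalSpace Y] (T : X ≃ₜ X) (S : Y ≃ₜ Y) (e : X ≃ₜ Y) (m : X → ℤ)
    (hm : ∀ x, e ((T.toEquiv ^ m x : Equiv.Perm X) x) = S (e x))
    (hc : {x : X | ¬ ContinuousAt m x}.Subsingleton) :
    cohomologicalAverages S ⊆ cohomologicalAverages T := by
  rintro r ⟨f, hf⟩
  refine ⟨⟨fun x => f (e x), by fun_prop⟩, fun ε hε => ?_⟩
  obtain ⟨N, hN, g, hg⟩ := hf ε hε
  obtain ⟨g', hg'⟩ := exists_coboundary_comp T S e m hm hc g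
  refine ⟨N, hN, g', fun x => ?_⟩
  rw [← hg']
  exact hg (e x)

lemma StrongOrbitEquiv.cohomologicalAverages_eq {X Y : Type*} [TopologicalSpace X] [CompactSpace X]
    [TopologicalSpace Y] [CompactSpace Y] {T : X ≃ₜ X} {S : Y ≃ₜ Y} (h : StrongOrbitEquiv T S) :
    cohomologicalAverages T = cohomologicalAverages S := by
  obtain ⟨e, -, n, m, hn, hm, hcn, hcm⟩ := h
  refine (cohomologicalAverages_subset S T e.symm (fun y => n (e.symm y)) (fun y => ?_) ?_).antisymm
    (cohomologicalAverages_subset T S e m hm hcm)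
  · rw [e.symm_apply_eq, hn, e.apply_symm_apply]
  · intro y hy y' hy'
    apply e.symm.injective
    refine hcn (fun h => hy ?_) (fun h => hy' ?_)
    · exact h.comp e.symm.continuous.continuousAt
    · exact h.comp e.symm.continuous.continuousAt

lemma cohomologicalAverage_unique {X : Type*} [TopologicalSpace X] [CompactSpace X] [Nonempty X]
    (T : X ≃ₜ X) (f : C(X, ℤ)) {r r' : ℝ}
    (hr : ∀ ε > (0 : ℝ), ∃ N : ℕ, 0 < N ∧ ∃ g : C(X, ℤ),
      ∀ x, |((N * f x + (g (T x) - g x) : ℤ) : ℝ) - N * r| ≤ N * ε)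
    (hr' : ∀ ε > (0 : ℝ), ∃ N : ℕ, 0 < N ∧ ∃ g : C(X, ℤ),
      ∀ x, |((N * f x + (g (T x) - g x) : ℤ) : ℝ) - N * r'| ≤ N * ε) : r' ≤ r := by
  by_contra! hlt
  obtain ⟨N, hN, g, hg⟩ := hr ((r' - r) / 3) (by linarith)
  obtain ⟨N', hN', g', hg'⟩ := hr' ((r' - r) / 3) (by linarith)
  have hmin := isCompact_univ.exists_isMinOn Set.univ_nonempty
    (f := fun x => N' * g x - N * g' x) (by fun_prop)
  obtain ⟨y, -, hy⟩ := hmin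
  have hmin := hy (Set.mem_univ (T y))
  simp only [Set.mem_ofPred_eq] at hmin
  have h1 := (abs_le.1 (hg y)).2
  have h2 := (abs_le.1 (hg' y)).1
  have h3 : (N' * (g y : ℝ) - N * g' y) ≤ N' * g (T y) - N * g' (T y) := by exact_mod_cast hmin
  push_cast at h1 h2
  have hNp : (0 : ℝ) < N := by exact_mod_cast hN
  have hNp' : (0 : ℝ) < N' := by exact_mod_cast hN'
  have h4 := mul_le_mul_of_nonneg_left h1 hNp'.le
  have h5 := mul_le_mul_of_nonneg_left h2 hNp.le
  have h6 : 0 < N * N' * (r' - r) := by have := sub_pos.2 hlt; positivity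
  nlinarith

lemma countable_cohomologicalAverages {X : Type*} [TopologicalSpace X] [CompactSpace X] [Nonempty X]
    [Countable C(X, ℤ)] (T : X ≃ₜ X) : (cohomologicalAverages T).Countable := by
  choose! F hF using fun (r : ℝ) (hr : r ∈ cohomologicalAverages T) => hr
  refine Set.MapsTo.countable_of_injOn (f := F) (Set.mapsTo_univ _ _) ?_ Set.countable_univ
  intro r hr r' hr' h
  have h1 := hF r hr
  have h2 := hF r' hr'
  rw [← h] at h2
  exact (cohomologicalAverage_unique T _ h2 h1).antisymm (cohomologicalAverage_unique T _ h1 h2)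

lemma countable_continuousMap_int {X : Type*} [TopologicalSpace X] [CompactSpace X]
    [SecondCountableTopology X] [R1Space X] : Countable C(X, ℤ) := by
  have hd : DiscreteTopology C(X, ℤ) := by
    refine DiscreteTopology.of_forall_le_dist one_pos fun f g hfg => ?_
    obtain ⟨x, hx⟩ : ∃ x, f x ≠ g x := by
      by_contra! h
      exact hfg (ContinuousMap.ext h)
    refine le_trans ?_ (ContinuousMap.dist_apply_le_dist x)
    rw [Int.dist_eq']
    exact_mod_cast Int.one_le_abs (sub_ne_zero.2 hx)
  exact countable_of_Lindelof_of_discrete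

/-- For a decreasing sequence of sets starting with everything, the last index `k` with
`n ∈ U k`. -/
noncomputable def holeLevel (U : ℕ → Set ℤ) (n : ℤ) : ℕ := sInf {k | n ∉ U (k + 1)}

lemma holeLevel_eq {U : ℕ → Set ℤ} (hU : Antitone U) {n : ℤ} {k : ℕ} (h : n ∈ U k)
    (h' : n ∉ U (k + 1)) : holeLevel U n = k := by
  refine le_antisymm (Nat.sInf_le h') (le_csInf ⟨k, h'⟩ fun j hj => ?_)
  by_contra! hlt
  exact hj (hU (Nat.succ_le_of_lt hlt) h)

lemma exists_mem_notMem_succ {U : ℕ → Set ℤ} {n : ℤ} {K : ℕ} (h₀ : n ∈ U 0)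
    (hK : n ∉ U K) : ∃ k < K, n ∈ U k ∧ n ∉ U (k + 1) := by
  induction K with
  | zero => exact absurd h₀ hK
  | succ K ih =>
    by_cases h : n ∈ U K
    · exact ⟨K, K.lt_succ_self, h, hK⟩
    · obtain ⟨k, hk, h'⟩ := ih h
      exact ⟨k, hk.trans K.lt_succ_self, h'⟩

/-- Periods `p k` together with decreasing `p k`-periodic sets `U k` of positions still undetermined
at stage `k`; the first `L ^ p k` blocks and the last block of length `p k` in each block of length
`p (k + 1)` are completely determined at stage `k + 1`. -/
structure HoleScheme (L : ℕ) where
  p : ℕ → ℕ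
  q : ℕ → ℕ
  U : ℕ → Set ℤ
  p_zero : p 0 = 1
  p_succ : ∀ k, p (k + 1) = p k * q k
  le_q : ∀ k, L ^ p k + 4 ≤ q k
  U_zero : U 0 = Set.univ
  U_periodic : ∀ k (n m : ℤ), n + m * p k ∈ U k ↔ n ∈ U k
  U_succ : ∀ k n, n ∈ U (k + 1) →
    n ∈ U k ∧ (L : ℤ) ^ p k ≤ n / p k % q k ∧ n / p k % q k + 1 < q k

namespace HoleScheme

variable {L : ℕ} (H : HoleScheme L)

lemma p_pos (k : ℕ) : 0 < H.p k := by
  induction k with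
  | zero => simp [H.p_zero]
  | succ k ih =>
    rw [H.p_succ]
    have := H.le_q k
    exact Nat.mul_pos ih (by omega)

lemma four_mul_p_le (k : ℕ) : 4 * H.p k ≤ H.p (k + 1) := by
  rw [H.p_succ, mul_comm]
  exact Nat.mul_le_mul_left _ ((Nat.le_add_left _ _).trans (H.le_q k))

lemma lt_p (k : ℕ) : k < H.p k := by
  induction k with
  | zero => exact H.p_pos 0
  | succ k ih => have := H.four_mul_p_le k; omega

lemma p_dvd {i j : ℕ} (h : i ≤ j) : H.p i ∣ H.p j := by
  induction j, h using Nat.le_induction with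
  | base => exact dvd_rfl
  | succ j _ ih => exact ih.trans ⟨_, H.p_succ j⟩

lemma p_mono {i j : ℕ} (h : i ≤ j) : H.p i ≤ H.p j := Nat.le_of_dvd (H.p_pos j) (H.p_dvd h)

lemma antitone_U : Antitone H.U := antitone_nat_of_succ_le fun k n hn => (H.U_succ k n hn).1

lemma mem_U_iff {k : ℕ} {n n' : ℤ} (h : (H.p k : ℤ) ∣ n' - n) : n' ∈ H.U k ↔ n ∈ H.U k := by
  obtain ⟨m, hm⟩ := h
  rw [← H.U_periodic k n m, show n + m * H.p k = n' by linarith]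

/-- The position, modulo `p k`, of the marker hole at stage `k`. -/
def z (k : ℕ) : ℕ := ∑ i ∈ Finset.range k, H.p i

lemma z_succ (k : ℕ) : H.z (k + 1) = H.z k + H.p k := Finset.sum_range_succ _ _

lemma z_lt (k : ℕ) : H.z k < H.p k := by
  induction k with
  | zero => simpa [z] using H.p_pos 0
  | succ k ih => have := H.four_mul_p_le k; rw [z_succ]; omega

/-- The marker hole at stage `k`, a single residue class modulo `p k`. -/
def M (k : ℕ) : Set ℤ := {n | (H.p k : ℤ) ∣ n - H.z k}

lemma M_zero : H.M 0 = Set.univ := by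
  ext n; simp [M, H.p_zero]

lemma antitone_M : Antitone H.M := by
  refine antitone_nat_of_succ_le fun k n hn => ?_
  have h1 : (H.p k : ℤ) ∣ n - H.z (k + 1) :=
    (Int.natCast_dvd_natCast.2 (H.p_dvd k.le_succ)).trans hn
  show (H.p k : ℤ) ∣ n - H.z k
  rw [show n - (H.z k : ℤ) = n - H.z (k + 1) + H.p k by rw [z_succ]; push_cast; ring]
  exact dvd_add h1 dvd_rfl

lemma mem_M_iff {k : ℕ} {n n' : ℤ} (h : (H.p k : ℤ) ∣ n' - n) : n' ∈ H.M k ↔ n ∈ H.M k := by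
  simp only [M, Set.mem_ofPred_eq]
  rw [show n' - (H.z k : ℤ) = (n' - n) + (n - H.z k) by ring]
  exact dvd_add_right h

lemma notMem_M_succ {k : ℕ} {n : ℤ} (h : -(H.p k : ℤ) ≤ n) (h' : n < H.p k) :
    n ∉ H.M (k + 1) := by
  intro hn
  have h1 := H.four_mul_p_le k
  have h2 := H.z_lt k
  have h3 := H.z_succ k
  have h4 : (H.p (k + 1) : ℤ) ∣ H.z (k + 1) - n := by
    rw [← neg_sub]; exact (dvd_neg).2 hn
  have := Int.le_of_dvd (by omega) h4
  omega

lemma exists_holeLevel_M_eq (k : ℕ) (n : ℤ) :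
    ∃ j : ℤ, 0 ≤ j ∧ j < H.p (k + 1) ∧ n + j ∈ H.M k ∧ n + j ∉ H.M (k + 1) := by
  have hp : (0 : ℤ) < H.p (k + 1) := by exact_mod_cast H.p_pos (k + 1)
  refine ⟨(H.z k - n) % H.p (k + 1), Int.emod_nonneg _ hp.ne', Int.emod_lt_of_pos _ hp, ?_, ?_⟩
  · rw [H.mem_M_iff (n := H.z k)]
    · simp [M]
    · refine (Int.natCast_dvd_natCast.2 (H.p_dvd k.le_succ)).trans ?_
      rw [Int.emod_def]
      exact ⟨-((H.z k - n) / H.p (k + 1)), by ring⟩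
  · rw [H.mem_M_iff (n := H.z k)]
    · simp only [M, Set.mem_ofPred_eq, z_succ]
      rw [← dvd_neg]
      intro h
      have := H.four_mul_p_le k
      have h1 := H.p_pos k
      have := Int.le_of_dvd (by push_cast; omega) h
      push_cast at this
      omega
    · rw [Int.emod_def]
      exact ⟨-((H.z k - n) / H.p (k + 1)), by ring⟩

/-- The component of the Toeplitz sequence that carries the odometer and the symbol frequency. -/
noncomputable def marker (s : ℕ → Bool) (n : ℤ) : Bool × Bool :=
  (decide (Even (holeLevel H.M n)), s (holeLevel H.M n))

lemma marker_congr (s : ℕ → Bool) {k : ℕ} {n n' : ℤ} (h : (H.p k : ℤ) ∣ n' - n)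
    (hn : n ∉ H.M k) : H.marker s n' = H.marker s n := by
  obtain ⟨j, hj, h1, h2⟩ := exists_mem_notMem_succ (by simp [H.M_zero]) hn
  have hd : ∀ i ≤ k, (H.p i : ℤ) ∣ n' - n := fun i hi =>
    (Int.natCast_dvd_natCast.2 (H.p_dvd hi)).trans h
  have h1' := (H.mem_M_iff (hd j hj.le)).2 h1
  have h2' := mt (H.mem_M_iff (hd (j + 1) hj)).1 h2
  rw [marker, marker, holeLevel_eq H.antitone_M h1 h2, holeLevel_eq H.antitone_M h1' h2']

variable [NeZero L]

lemma notMem_U_succ {k : ℕ} {n : ℤ} (h : -(H.p k : ℤ) ≤ n) (h' : n < H.p k) : n ∉ H.U (k + 1) := by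
  intro hn
  obtain ⟨-, h1, h2⟩ := H.U_succ k n hn
  have hp : (0 : ℤ) < H.p k := by exact_mod_cast H.p_pos k
  have hq : (4 : ℤ) ≤ H.q k := by exact_mod_cast (Nat.le_add_left _ _).trans (H.le_q k)
  rcases lt_or_ge n 0 with h0 | h0
  · have : n / H.p k = -1 := by
      rw [Int.ediv_eq_iff_of_pos hp]; constructor <;> linarith
    rw [this, Int.emod_eq_add_self_emod, Int.emod_eq_of_lt (by omega) (by omega)] at h2
    omega
  · rw [Int.ediv_eq_zero_of_lt h0 h', Int.zero_emod] at h1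
    have : (0 : ℤ) < (L : ℤ) ^ H.p k := by
      have : (0 : ℤ) < L := by exact_mod_cast Nat.pos_of_neZero L
      positivity
    omega

/-- The `r`-th digit of `b` in base `L`. -/
def digit (L : ℕ) [NeZero L] (b r : ℕ) : Fin L := Fin.ofNat L (b / L ^ r)

lemma exists_digit_eq (L : ℕ) [NeZero L] (N : ℕ) (g : ℕ → Fin L) :
    ∃ b < L ^ N, ∀ r < N, digit L b r = g r := by
  let b := finFunctionFinEquiv fun i : Fin N => g i
  refine ⟨b, b.2, fun r hr => ?_⟩
  have : finFunctionFinEquiv.symm b ⟨r, hr⟩ = g r := by simp [b]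
  rw [← this]
  rfl

/-- The symbol filled in at stage `k + 1` at position `n`. -/
def stageSymbol (k : ℕ) (n : ℤ) : Fin L :=
  digit L (n / H.p k % H.q k).toNat (n % H.p k).toNat

/-- The component of the Toeplitz sequence that carries the entropy. -/
noncomputable def bulk (n : ℤ) : Fin L := H.stageSymbol (holeLevel H.U n) n

/-- The Toeplitz sequence of a scheme and a binary sequence. -/
noncomputable def seq (s : ℕ → Bool) (n : ℤ) : Fin L × Bool × Bool := (H.bulk n, H.marker s n)

lemma stageSymbol_congr {k : ℕ} {n n' : ℤ} (h : (H.p (k + 1) : ℤ) ∣ n' - n) :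
    H.stageSymbol k n' = H.stageSymbol k n := by
  obtain ⟨m, hm⟩ := h
  have hp : (H.p k : ℤ) ≠ 0 := by exact_mod_cast (H.p_pos k).ne'
  have : n' = n + H.p k * (H.q k * m) := by
    rw [← mul_assoc, ← Nat.cast_mul, ← H.p_succ]; linarith
  rw [this, stageSymbol, stageSymbol, Int.add_mul_ediv_left _ _ hp, Int.add_mul_emod_self_left,
    Int.add_mul_emod_self_left]

lemma bulk_congr {k : ℕ} {n n' : ℤ} (h : (H.p k : ℤ) ∣ n' - n) (hn : n ∉ H.U k) :
    H.bulk n' = H.bulk n := by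
  obtain ⟨j, hj, h1, h2⟩ := exists_mem_notMem_succ (by simp [H.U_zero]) hn
  have hd : ∀ i ≤ k, (H.p i : ℤ) ∣ n' - n := fun i hi =>
    (Int.natCast_dvd_natCast.2 (H.p_dvd hi)).trans h
  have h1' := (H.mem_U_iff (hd j hj.le)).2 h1
  have h2' := mt (H.mem_U_iff (hd (j + 1) hj)).1 h2
  rw [bulk, bulk, holeLevel_eq H.antitone_U h1 h2, holeLevel_eq H.antitone_U h1' h2',
    H.stageSymbol_congr (hd (j + 1) hj)]

lemma seq_add_mul (s : ℕ → Bool) {k : ℕ} {n : ℤ} (h : -(H.p k : ℤ) ≤ n) (h' : n < H.p k) (m : ℤ) :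
    H.seq s (n + m * H.p (k + 1)) = H.seq s n := by
  have hd : (H.p (k + 1) : ℤ) ∣ n + m * H.p (k + 1) - n := by simp
  rw [seq, seq, H.bulk_congr hd (H.notMem_U_succ h h'), H.marker_congr s hd (H.notMem_M_succ h h')]

lemma isToeplitz_seq (s : ℕ → Bool) : IsToeplitz (H.seq s) := fun n => by
  have := H.lt_p n.natAbs
  exact ⟨H.p (n.natAbs + 1), by exact_mod_cast H.p_pos _, fun m =>
    H.seq_add_mul s (by omega) (by omega) m⟩

/-- Agreement on a long window determines the position modulo `p k`. -/
lemma dvd_sub_of_agree (s : ℕ → Bool) (k : ℕ) {n n' : ℤ}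
    (h : ∀ j : ℤ, 0 ≤ j → j < H.p (k + 1) → H.seq s (n + j) = H.seq s (n' + j)) :
    (H.p k : ℤ) ∣ n' - n := by
  induction k with
  | zero => simp [H.p_zero]
  | succ k ih =>
    have hk : (H.p (k + 1) : ℤ) ≤ H.p (k + 2) := by exact_mod_cast H.p_mono (Nat.le_succ _)
    have h1 := ih fun j h0 hj => h j h0 (hj.trans_le hk)
    by_contra h2
    obtain ⟨j, hj0, hj, hM, hM'⟩ := H.exists_holeLevel_M_eq (k + 1) n
    have h3 : n' + j ∈ H.M k :=
      (H.mem_M_iff (n := n + j) (by convert h1 using 1; ring)).2 (H.antitone_M k.le_succ hM)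
    have h4 : n' + j ∉ H.M (k + 1) := by
      intro h4
      apply h2
      rw [show n' - n = (n' + j - H.z (k + 1)) - (n + j - H.z (k + 1)) by ring]
      exact dvd_sub h4 hM
    have h5 := h j hj0 hj
    simp only [seq, marker, holeLevel_eq H.antitone_M hM hM', holeLevel_eq H.antitone_M h3 h4,
      Prod.mk.injEq, decide_eq_decide] at h5
    have := h5.2.1
    rw [Nat.even_add_one] at this
    tauto

lemma isNonperiodic_seq (s : ℕ → Bool) : IsNonperiodic (H.seq s) := by
  rintro ⟨P, hP, h⟩
  have h1 := H.dvd_sub_of_agree s P.natAbs (n := 0) (n' := P)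
    fun j _ _ => by rw [zero_add, add_comm, h]
  have h2 := H.lt_p P.natAbs
  have := Int.le_of_dvd (by omega) h1
  omega

/-- All fillings of the holes of stage `k` occur in blocks of length `p k`. -/
lemma exists_bulk_eq (k : ℕ) (g : ℕ → Fin L) :
    ∃ b : ℤ, ∀ r < H.p k, (r : ℤ) ∈ H.U k → H.bulk (b * H.p k + r) = g r := by
  obtain ⟨b, hb, hg⟩ := exists_digit_eq L (H.p k) g
  refine ⟨b, fun r hr hrU => ?_⟩
  have hp : (0 : ℤ) < H.p k := by exact_mod_cast H.p_pos k
  have hbq : b < H.q k := by have := H.le_q k; omega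
  have hdiv : ((b : ℤ) * H.p k + r) / H.p k = b := by
    rw [add_comm, Int.add_mul_ediv_right _ _ hp.ne', Int.ediv_eq_zero_of_lt (by omega) (by omega),
      zero_add]
  have hmod : ((b : ℤ) * H.p k + r) % H.p k = r := by
    rw [add_comm, Int.add_mul_emod_self_right, Int.emod_eq_of_lt (by omega) (by omega)]
  have hmodq : (b : ℤ) % H.q k = b := Int.emod_eq_of_lt (by omega) (by omega)
  have h1 : (b : ℤ) * H.p k + r ∈ H.U k := by
    rw [add_comm, H.U_periodic]; exact hrU
  have h2 : (b : ℤ) * H.p k + r ∉ H.U (k + 1) := by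
    intro h
    have := (H.U_succ k _ h).2.1
    rw [hdiv, hmodq] at this
    have : L ^ H.p k ≤ b := by exact_mod_cast this
    omega
  rw [bulk, holeLevel_eq H.antitone_U h1 h2, stageSymbol, hdiv, hmod, hmodq, Int.toNat_natCast,
    Int.toNat_natCast, hg r hr]

end HoleScheme

namespace HoleScheme

variable {L : ℕ} (H : HoleScheme L)

/-- The frequency with which the marker hole is filled exactly at stage `i + 1`. -/
noncomputable def weight (i : ℕ) : ℝ := 1 / H.p i - 1 / H.p (i + 1)

/-- The frequency of the symbol `true` contributed by the first `k` stages. -/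
noncomputable def partialFreq (s : ℕ → Bool) (k : ℕ) : ℝ :=
  ∑ i ∈ Finset.range k, if s i then H.weight i else 0

/-- The frequency of the symbol `true` in the last component of `seq`. -/
noncomputable def freq (s : ℕ → Bool) : ℝ := ⨆ k, H.partialFreq s k

lemma p_inv_pos (k : ℕ) : 0 < (1 : ℝ) / H.p k := by
  have := H.p_pos k
  positivity

lemma four_mul_inv_le (k : ℕ) : 4 * ((1 : ℝ) / H.p (k + 1)) ≤ 1 / H.p k := by
  have h1 : (0 : ℝ) < H.p k := by exact_mod_cast H.p_pos k
  have h2 : (0 : ℝ) < H.p (k + 1) := by exact_mod_cast H.p_pos (k + 1)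
  have h3 : (4 : ℝ) * H.p k ≤ H.p (k + 1) := by exact_mod_cast H.four_mul_p_le k
  rw [mul_one_div, div_le_div_iff₀ h2 h1]
  linarith

lemma weight_pos (i : ℕ) : 0 < H.weight i := by
  have h1 := H.four_mul_inv_le i
  have h2 := H.p_inv_pos (i + 1)
  unfold weight
  linarith

lemma monotone_partialFreq (s : ℕ → Bool) : Monotone (H.partialFreq s) :=
  monotone_nat_of_le_succ fun k => by
    rw [partialFreq, partialFreq, Finset.sum_range_succ]
    have := H.weight_pos k
    split_ifs <;> linarith

lemma antitone_partialFreq_add (s : ℕ → Bool) :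
    Antitone fun k => H.partialFreq s k + 1 / H.p k :=
  antitone_nat_of_succ_le fun k => by
    simp only [partialFreq]
    rw [Finset.sum_range_succ]
    have h1 := H.four_mul_inv_le k
    have h2 := H.p_inv_pos (k + 1)
    unfold weight
    split_ifs <;> linarith

lemma partialFreq_le_add (s : ℕ → Bool) (j k : ℕ) :
    H.partialFreq s j ≤ H.partialFreq s k + 1 / H.p k := by
  have h1 := H.monotone_partialFreq s (le_max_left j k)
  have h2 := H.antitone_partialFreq_add s (le_max_right j k)
  have h3 := H.p_inv_pos (max j k)
  simp only at h2
  linarith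

lemma partialFreq_le_freq (s : ℕ → Bool) (k : ℕ) : H.partialFreq s k ≤ H.freq s :=
  le_ciSup (f := H.partialFreq s)
    ⟨_, by rintro _ ⟨j, rfl⟩; exact H.partialFreq_le_add s j 0⟩ k

lemma freq_le (s : ℕ → Bool) (k : ℕ) : H.freq s ≤ H.partialFreq s k + 1 / H.p k :=
  ciSup_le fun j => H.partialFreq_le_add s j k

lemma freq_injective : Function.Injective H.freq := by
  have key : ∀ s s' : ℕ → Bool, H.freq s = H.freq s' → ∀ k, (∀ i < k, s i = s' i) →
      s k = true → s' k = true := by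
    intro s s' h k hk hs
    by_contra hs'
    have hP : H.partialFreq s k = H.partialFreq s' k :=
      Finset.sum_congr rfl fun i hi => by rw [hk i (Finset.mem_range.1 hi)]
    have h1 := H.partialFreq_le_freq s (k + 1)
    have h2 := H.freq_le s' (k + 1)
    have h3 := H.four_mul_inv_le k
    have h4 := H.p_inv_pos (k + 1)
    rw [partialFreq, Finset.sum_range_succ, ← partialFreq, if_pos hs] at h1
    rw [partialFreq, Finset.sum_range_succ, ← partialFreq, if_neg hs'] at h2
    unfold weight at h1
    linarith
  intro s s' h
  funext k
  induction k using Nat.strong_induction_on with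
  | _ k ih =>
    rw [Bool.eq_iff_iff]
    exact ⟨key s s' h k ih, key s' s h.symm k fun i hi => (ih i hi).symm⟩

open Classical in
lemma sum_indicator_M {i k : ℕ} (hik : i ≤ k) (n : ℤ) :
    ∑ j ∈ Finset.range (H.p k), (if n + (j : ℤ) ∈ H.M i then (1 : ℝ) else 0) =
      H.p k / H.p i := by
  obtain ⟨m, hm⟩ := H.p_dvd hik
  have hp : (0 : ℤ) < H.p i := by exact_mod_cast H.p_pos i
  have hp' : (H.p i : ℝ) ≠ 0 := by exact_mod_cast hp.ne'
  rw [Finset.sum_boole]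
  have h1 : (Finset.range (H.p k)).filter (fun j : ℕ => n + (j : ℤ) ∈ H.M i) =
      (Finset.range (H.p k)).filter (fun j : ℕ => j ≡ ((H.z i - n) % H.p i).toNat [MOD H.p i]) := by
    refine Finset.filter_congr fun j _ => ?_
    rw [← Int.natCast_modEq_iff, Int.toNat_of_nonneg (Int.emod_nonneg _ hp.ne')]
    have : (j : ℤ) ≡ (H.z i - n) % H.p i [ZMOD H.p i] ↔ (j : ℤ) ≡ H.z i - n [ZMOD H.p i] := by
      unfold Int.ModEq; rw [Int.emod_emod]
    rw [this, Int.modEq_comm, Int.modEq_iff_dvd]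
    simp only [M, Set.mem_ofPred_eq]
    rw [show n + (j : ℤ) - H.z i = j - (H.z i - n) by ring]
  rw [h1, ← Nat.count_eq_card_filter_range, Nat.count_modEq_card _ (H.p_pos i), hm]
  rw [Nat.mul_div_cancel_left _ (H.p_pos i), Nat.mul_mod_right]
  simp
  field_simp

open Classical in
lemma indicator_true_eq (s : ℕ → Bool) (k : ℕ) (n : ℤ) :
    (if (H.marker s n).2 then (1 : ℝ) else 0) =
      (∑ i ∈ Finset.range k, if s i then
        (if n ∈ H.M i then (1 : ℝ) else 0) - (if n ∈ H.M (i + 1) then 1 else 0) else 0) +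
      if n ∈ H.M k then (if (H.marker s n).2 then 1 else 0) else 0 := by
  induction k with
  | zero => simp [H.M_zero]
  | succ k ih =>
    rw [Finset.sum_range_succ, add_assoc]
    refine ih.trans ?_
    congr 1
    by_cases h : n ∈ H.M k
    · by_cases h' : n ∈ H.M (k + 1)
      · simp [h, h']
      · simp [h, h', marker, holeLevel_eq H.antitone_M h h']
    · have h' : n ∉ H.M (k + 1) := fun h' => h (H.antitone_M k.le_succ h')
      simp [h, h']

open Classical in
lemma abs_sum_true_sub_le (s : ℕ → Bool) (k : ℕ) (n : ℤ) :
    |∑ j ∈ Finset.range (H.p k), (if (H.marker s (n + (j : ℤ))).2 then (1 : ℝ) else 0) -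
      H.p k * H.freq s| ≤ 2 := by
  have hp : (0 : ℝ) < H.p k := by exact_mod_cast H.p_pos k
  have h1 : ∑ j ∈ Finset.range (H.p k), (if (H.marker s (n + (j : ℤ))).2 then (1 : ℝ) else 0) =
      H.p k * H.partialFreq s k + ∑ j ∈ Finset.range (H.p k), (if n + (j : ℤ) ∈ H.M k then
        (if (H.marker s (n + (j : ℤ))).2 then (1 : ℝ) else 0) else 0) := by
    refine (Finset.sum_congr rfl fun (j : ℕ) _ => H.indicator_true_eq s k (n + (j : ℤ))).trans ?_
    rw [Finset.sum_add_distrib, Finset.sum_comm, partialFreq, Finset.mul_sum]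
    congr 1
    refine Finset.sum_congr rfl fun i hi => ?_
    have hi := Finset.mem_range.1 hi
    split_ifs with hs
    · rw [Finset.sum_sub_distrib, H.sum_indicator_M hi.le, H.sum_indicator_M hi, weight]
      ring
    · simp
  have h2 : ∑ j ∈ Finset.range (H.p k), (if n + (j : ℤ) ∈ H.M k then
        (if (H.marker s (n + (j : ℤ))).2 then (1 : ℝ) else 0) else 0) ≤ 1 := by
    refine le_trans (Finset.sum_le_sum fun j _ => ?_)
      ((H.sum_indicator_M le_rfl n).trans (div_self hp.ne')).le
    split_ifs <;> norm_num
  have h3 : 0 ≤ ∑ j ∈ Finset.range (H.p k), (if n + (j : ℤ) ∈ H.M k then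
        (if (H.marker s (n + (j : ℤ))).2 then (1 : ℝ) else 0) else 0) :=
    Finset.sum_nonneg fun j _ => by split_ifs <;> norm_num
  have h4 := mul_le_mul_of_nonneg_left (H.partialFreq_le_freq s k) hp.le
  have h5 := mul_le_mul_of_nonneg_left (H.freq_le s k) hp.le
  rw [mul_add, mul_one_div_cancel hp.ne'] at h5
  rw [h1, abs_le]
  constructor <;> linarith

end HoleScheme

namespace ToeplitzFlow

variable (F : ToeplitzFlow)

lemma T_apply (x : F.X) (j : ℤ) : (F.T x).1 j = x.1 (j + 1) := rfl

lemma iterate_T_apply (x : F.X) (k : ℕ) (j : ℤ) : (F.T^[k] x).1 j = x.1 (j + k) := by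
  induction k generalizing x with
  | zero => simp
  | succ k ih =>
    rw [Function.iterate_succ_apply, ih, T_apply]
    exact congrArg x.1 (by push_cast; ring)

/-- The shift of `F.η` by `n`, as a point of the flow. -/
def orbitPoint (n : ℤ) : F.X := ⟨fun k => F.η (k + n), subset_closure ⟨n, rfl⟩⟩

lemma orbitPoint_apply (n j : ℤ) : (F.orbitPoint n).1 j = F.η (j + n) := rfl

instance : Nonempty F.X := ⟨F.orbitPoint 0⟩

instance : CompactSpace F.X := isCompact_iff_compactSpace.1 isClosed_closure.isCompact

/-- The entourage of pairs of points that agree on `[-W, W]`. -/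
def agree (W : ℕ) : Set (F.X × F.X) := {z | ∀ j : ℤ, |j| ≤ W → z.1.1 j = z.2.1 j}

open Uniformity in
lemma hasBasis_agree : (𝓤 F.X).HasBasis (fun _ : ℕ => True) F.agree := by
  refine ⟨fun V => ⟨fun hV => ?_, ?_⟩⟩
  · obtain ⟨V', hV', hsub⟩ := hV
    rw [Pi.uniformity, Filter.mem_iInf'] at hV'
    obtain ⟨I, hI, v, hv, -, rfl, -⟩ := hV'
    obtain ⟨W, hW⟩ : ∃ W : ℕ, ∀ j ∈ I, |j| ≤ (W : ℤ) := by
      obtain ⟨W, hW⟩ := (hI.image fun j : ℤ => j.natAbs).bddAbove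
      exact ⟨W, fun j hj => by have := hW ⟨j, hj, rfl⟩; rw [Int.abs_eq_natAbs]; exact_mod_cast this⟩
    refine ⟨W, trivial, fun z hz => hsub ?_⟩
    refine Set.mem_iInter₂.2 fun j hj => ?_
    obtain ⟨w, hw, hwv⟩ := hv j
    refine hwv ?_
    have := hz j (hW j hj)
    simp only [Set.mem_preimage, this]
    exact refl_mem_uniformity hw
  · rintro ⟨W, -, hW⟩
    refine Filter.mem_of_superset ?_ hW
    have : F.agree W = ⋂ j ∈ Set.Icc (-(W : ℤ)) W, {z | z.1.1 j = z.2.1 j} := by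
      ext z
      simp [agree, abs_le]
    rw [this, Filter.biInter_mem (Set.finite_Icc _ _)]
    intro j _
    have huc : UniformContinuous fun x : F.X => x.1 j :=
      (Pi.uniformContinuous_proj _ j).comp uniformContinuous_subtype_val
    have h1 : {z : F.Λ × F.Λ | z.1 = z.2} ∈ 𝓤 F.Λ := Filter.mem_principal.2 fun z hz => hz
    exact huc h1

lemma denseRange_orbitPoint : DenseRange F.orbitPoint := by
  intro y
  rw [closure_subtype]
  refine closure_mono ?_ y.2
  rintro _ ⟨n, rfl⟩
  exact ⟨_, ⟨n, rfl⟩, rfl⟩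

lemma T_orbitPoint (n : ℤ) : F.T (F.orbitPoint n) = F.orbitPoint (n + 1) := by
  ext j
  simp only [T_apply, orbitPoint_apply]
  congr 1; ring

lemma ball_agree_mem_nhds (x : F.X) (W : ℕ) : UniformSpace.ball x (F.agree W) ∈ nhds x :=
  UniformSpace.ball_mem_nhds x (F.hasBasis_agree.mem_of_mem trivial)

lemma exists_orbitPoint_mem_agree (x : F.X) (W : ℕ) : ∃ n : ℤ, (x, F.orbitPoint n) ∈ F.agree W := by
  obtain ⟨_, hy, n, rfl⟩ :=
    mem_closure_iff_nhds.1 (F.denseRange_orbitPoint x) _ (F.ball_agree_mem_nhds x W)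
  exact ⟨n, hy⟩

lemma isLocallyConstant_of_agree {α : Type*} {f : F.X → α} (W : ℕ)
    (h : ∀ x y, (x, y) ∈ F.agree W → f x = f y) : IsLocallyConstant f := by
  rw [IsLocallyConstant.iff_eventually_eq]
  intro x
  filter_upwards [F.ball_agree_mem_nhds x W] with y hy
  exact (h x y hy).symm

lemma countable_cohomologicalAverages_T : (cohomologicalAverages F.T).Countable := by
  have := countable_continuousMap_int (X := F.X)
  exact countable_cohomologicalAverages F.T

end ToeplitzFlow

namespace HoleScheme

variable {L : ℕ} [NeZero L] (H : HoleScheme L)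

/-- The Toeplitz flow of a scheme and a binary sequence. -/
noncomputable def flow (s : ℕ → Bool) : ToeplitzFlow where
  Λ := Fin L × Bool × Bool
  η := H.seq s
  toeplitz := H.isToeplitz_seq s
  nonperiodic := H.isNonperiodic_seq s

/-- Frequencies are cohomological averages. -/
lemma freq_mem_cohomologicalAverages (s : ℕ → Bool) :
    H.freq s ∈ cohomologicalAverages (H.flow s).T := by
  let F := H.flow s
  let f₀ : F.X → ℤ := fun x => if (x.1 0 : Fin L × Bool × Bool).2.2 then 1 else 0
  have hf₀ : IsLocallyConstant f₀ := F.isLocallyConstant_of_agree 0 fun x y h => by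
    simp only [f₀, show x.1 0 = y.1 0 from h 0 (by simp)]
  let f : C(F.X, ℤ) := ⟨f₀, hf₀.continuous⟩
  refine ⟨f, fun ε hε => ?_⟩
  obtain ⟨k, hk⟩ := exists_nat_gt (2 / ε)
  have hk' : 2 ≤ H.p k * ε := by
    have : (k : ℝ) < H.p k := by exact_mod_cast H.lt_p k
    rw [← div_le_iff₀ hε]; linarith
  have hcob : ∑ j ∈ Finset.range (H.p k), (compZPow F.T f j - f) ∈ intCoboundaries F.T :=
    sum_mem fun j _ => compZPow_sub_mem_intCoboundaries F.T f j
  obtain ⟨g, hg⟩ := hcob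
  refine ⟨H.p k, H.p_pos k, g, fun x => ?_⟩
  obtain ⟨n, hn⟩ := F.exists_orbitPoint_mem_agree x (H.p k)
  have h1 : ((H.p k * f x + (g (F.T x) - g x) : ℤ) : ℝ) =
      ∑ j ∈ Finset.range (H.p k), (if (H.marker s (n + (j : ℤ))).2 then (1 : ℝ) else 0) := by
    rw [← hg x]
    have h2 : ∀ j ∈ Finset.range (H.p k), compZPow F.T f j x =
        if (H.marker s (n + (j : ℤ))).2 then (1 : ℤ) else 0 := by
      intro j hj
      have h3 : ((F.T.toEquiv ^ (j : ℤ) : Equiv.Perm F.X) x) = F.T^[j] x := by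
        rw [zpow_natCast, ← Equiv.Perm.iterate_eq_pow]; rfl
      have h4 : (F.T^[j] x).1 0 = H.seq s (n + (j : ℤ)) := by
        rw [F.iterate_T_apply, zero_add, hn j (by
          have := Finset.mem_range.1 hj; rw [Nat.abs_cast]; exact_mod_cast this.le),
          F.orbitPoint_apply, add_comm]
        rfl
      show f₀ _ = _
      rw [h3]
      simp only [f₀, h4]
      rfl
    have h5 : (∑ j ∈ Finset.range (H.p k), (compZPow F.T f j - f)) x =
        ∑ j ∈ Finset.range (H.p k), (compZPow F.T f j x) - H.p k * f x := by
      simp [ContinuousMap.sum_apply]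
    rw [h5, Finset.sum_congr rfl h2]
    push_cast
    simp
  rw [h1]
  exact (H.abs_sum_true_sub_le s k n).trans hk'

end HoleScheme

lemma eq_one_of_norm_pow_sub_one_le {z : ℂ} (h : ∀ m : ℕ, ‖z ^ m - 1‖ ≤ 1 / 2) : z = 1 := by
  have h1 : ∀ i : ℕ, (3 / 2 : ℝ) ^ i * ‖z - 1‖ ≤ ‖z ^ 2 ^ i - 1‖ := by
    intro i
    induction i with
    | zero => simp
    | succ i ih =>
      have h2 : z ^ 2 ^ (i + 1) - 1 = (z ^ 2 ^ i - 1) * (z ^ 2 ^ i + 1) := by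
        rw [pow_succ 2 i, pow_mul]; ring
      have h3 : 3 / 2 ≤ ‖z ^ 2 ^ i + 1‖ := by
        have h4 := norm_sub_norm_le (2 : ℂ) (-(z ^ 2 ^ i - 1))
        have h5 : (2 : ℂ) - -(z ^ 2 ^ i - 1) = z ^ 2 ^ i + 1 := by ring
        rw [h5, norm_neg] at h4
        have := h (2 ^ i)
        norm_num at h4
        linarith
      rw [h2, norm_mul, pow_succ]
      nlinarith [norm_nonneg (z ^ 2 ^ i - 1)]
  by_contra hz
  have hpos : 0 < ‖z - 1‖ := norm_pos_iff.2 (sub_ne_zero.2 hz)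
  obtain ⟨i, hi⟩ := pow_unbounded_of_one_lt (1 / ‖z - 1‖) (by norm_num : (1 : ℝ) < 3 / 2)
  rw [div_lt_iff₀ hpos] at hi
  linarith [h1 i, h (2 ^ i)]

namespace HoleScheme

variable {L : ℕ} [NeZero L] (H : HoleScheme L)

lemma exists_eigenfunction (s : ℕ → Bool) (m : ℤ) (k : ℕ) :
    ∃ f : C((H.flow s).X, ℂ), f ≠ 0 ∧
      ∀ x, f ((H.flow s).T x) = Complex.exp (2 * Real.pi * Complex.I * m / H.p k) * f x := by
  let F := H.flow s
  choose pos hpos using fun x : F.X => F.exists_orbitPoint_mem_agree x (H.p (k + 1))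
  let e : ℤ → ℂ := fun n => Complex.exp (2 * Real.pi * Complex.I * m / H.p k * n)
  have hp : (H.p k : ℂ) ≠ 0 := by exact_mod_cast (H.p_pos k).ne'
  have he : ∀ n n', (H.p k : ℤ) ∣ n' - n → e n = e n' := by
    rintro n n' ⟨c, hc⟩
    rw [Complex.exp_eq_exp_iff_exists_int]
    refine ⟨-(m * c), ?_⟩
    have : (n' : ℂ) = n + H.p k * c := by
      have : n' = n + H.p k * c := by linarith
      rw [this]; push_cast; rfl
    rw [this]
    push_cast
    field_simp
    ring
  have hlc : IsLocallyConstant fun x => e (pos x) := F.isLocallyConstant_of_agree (H.p (k + 1))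
    fun x y hxy => he _ _ <| H.dvd_sub_of_agree s k fun j h0 hj => by
      have h1 : |j| ≤ H.p (k + 1) := by rw [abs_of_nonneg h0]; exact hj.le
      have hx := hpos x j h1
      have hy := hpos y j h1
      have hxy := hxy j h1
      simp only [F.orbitPoint_apply] at hx hy
      rw [add_comm, add_comm (pos y)]
      exact hx.symm.trans (hxy.trans hy)
  refine ⟨⟨_, hlc.continuous⟩, fun h => ?_, fun x => ?_⟩
  · have := DFunLike.congr_fun h (F.orbitPoint 0)
    exact Complex.exp_ne_zero _ this
  · have h1 : e (pos (F.T x)) = e (pos x + 1) := by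
      refine (he _ _ <| H.dvd_sub_of_agree s k fun j h0 hj => ?_).symm
      have hx := hpos x (j + 1) (by rw [abs_of_nonneg (by omega)]; omega)
      have hy := hpos (F.T x) j (by rw [abs_of_nonneg h0]; exact hj.le)
      simp only [F.orbitPoint_apply, F.T_apply] at hx hy
      rw [show pos x + 1 + j = j + 1 + pos x by ring, add_comm (pos (F.T x))]
      exact hx.symm.trans hy
    show e (pos (F.T x)) = _ * e (pos x)
    rw [h1, ← Complex.exp_add]
    simp only [e]
    congr 1
    push_cast
    ring

lemma exists_eq_exp_of_eigenfunction (s : ℕ → Bool) {lam : ℂ} (f : C((H.flow s).X, ℂ))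
    (hf : f ≠ 0) (h : ∀ x, f ((H.flow s).T x) = lam * f x) :
    ∃ (m : ℤ) (k : ℕ), lam = Complex.exp (2 * Real.pi * Complex.I * m / H.p k) := by
  let F := H.flow s
  have hiter : ∀ n (k : ℕ), f (F.orbitPoint (n + k)) = lam ^ k * f (F.orbitPoint n) := by
    intro n k
    induction k with
    | zero => simp
    | succ k ih =>
      have := h (F.orbitPoint (n + k))
      rw [F.T_orbitPoint, ih] at this
      rw [pow_succ', mul_assoc, ← this]
      congr 2; push_cast; ring
  have h0 : f (F.orbitPoint 0) ≠ 0 := by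
    intro h0
    apply hf
    have hlam : lam ≠ 0 := by
      rintro rfl
      apply hf
      ext x
      have := h (F.T.symm x)
      rw [zero_mul] at this
      exact (congrArg f (F.T.apply_symm_apply x)).symm.trans this
    refine DFunLike.coe_injective (F.denseRange_orbitPoint.equalizer f.continuous
      continuous_const (funext fun n => ?_))
    obtain ⟨k, rfl | rfl⟩ := n.eq_nat_or_neg
    · have := hiter 0 k
      rwa [h0, mul_zero, zero_add] at this
    · have := hiter (-k) k
      rw [neg_add_cancel, h0] at this
      simpa [hlam] using this.symm
  obtain ⟨W, -, hW⟩ := ((nhds_basis_uniformity' F.hasBasis_agree).tendsto_left_iff.1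
    (f.continuous.tendsto (F.orbitPoint 0))) _
      (Metric.ball_mem_nhds _ (half_pos (norm_pos_iff.2 h0)))
  have hpW := H.lt_p W
  have hroot : lam ^ H.p (W + 1) = 1 := by
    refine eq_one_of_norm_pow_sub_one_le fun m => ?_
    have h1 : F.orbitPoint ((m * H.p (W + 1) : ℕ) : ℤ) ∈
        UniformSpace.ball (F.orbitPoint 0) (F.agree W) := by
      intro j hj
      rw [abs_le] at hj
      simp only [F.orbitPoint_apply, add_zero]
      have := H.seq_add_mul s (k := W) (n := j) (by omega) (by omega) m
      push_cast
      exact this.symm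
    have h2 := hW h1
    have h3 := hiter 0 (m * H.p (W + 1))
    rw [zero_add] at h3
    rw [h3, Metric.mem_ball, dist_eq_norm, mul_comm m, pow_mul,
      show (lam ^ H.p (W + 1)) ^ m * f (F.orbitPoint 0) - f (F.orbitPoint 0) =
        ((lam ^ H.p (W + 1)) ^ m - 1) * f (F.orbitPoint 0) by ring, norm_mul] at h2
    have h4 : 0 < ‖f (F.orbitPoint 0)‖ := norm_pos_iff.2 h0
    nlinarith
  have hp := H.p_pos (W + 1)
  have : NeZero (H.p (W + 1)) := ⟨hp.ne'⟩
  obtain ⟨i, -, hi⟩ := (Complex.isPrimitiveRoot_exp _ hp.ne').eq_pow_of_pow_eq_one hroot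
  refine ⟨i, W + 1, ?_⟩
  rw [← hi, ← Complex.exp_nat_mul]
  congr 1
  push_cast
  ring

end HoleScheme

namespace ToeplitzFlow

variable (F : ToeplitzFlow)

lemma mem_dynEntourage_agree {W n : ℕ} {x y : F.X} :
    (x, y) ∈ Dynamics.dynEntourage F.T (F.agree W) n ↔
      ∀ i < n, ∀ j : ℤ, |j| ≤ W → x.1 (j + i) = y.1 (j + i) := by
  rw [Dynamics.mem_dynEntourage]
  simp only [agree, Set.mem_ofPred_eq, iterate_T_apply]

instance (W : ℕ) : SetRel.IsSymm (F.agree W) := ⟨fun _ _ h j hj => (h j hj).symm⟩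

/-- A finite code that determines the words of length `n + 2 * W` bounds the entropy. -/
lemma coverEntropyEntourage_agree_le {ι : Type*} [Fintype ι] (W : ℕ) {n : ℕ} (hn : n ≠ 0)
    (c : ℤ → ι) (hc : ∀ a a' : ℤ, c a = c a' →
      ∀ j : ℤ, -(W : ℤ) ≤ j → j < n + W → F.η (j + a) = F.η (j + a')) :
    Dynamics.coverEntropyEntourage F.T Set.univ (F.agree W) ≤
      ((Real.log (Fintype.card ι) / n : ℝ) : EReal) := by
  classical
  have hne : Nonempty ι := ⟨c 0⟩
  let s : Finset F.X := Finset.univ.image fun i : ι => F.orbitPoint (Function.invFun c i)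
  have hs : Dynamics.IsDynCoverOf F.T Set.univ (F.agree W) n s := by
    intro x _
    obtain ⟨a, ha⟩ := F.exists_orbitPoint_mem_agree x (n + W)
    refine ⟨F.orbitPoint (Function.invFun c (c a)), ?_, ?_⟩
    · exact Finset.mem_coe.2 (Finset.mem_image_of_mem _ (Finset.mem_univ _))
    · rw [mem_dynEntourage_agree]
      intro i hi j hj
      rw [abs_le] at hj
      have h1 := ha (j + i) (by push_cast; rw [abs_le]; omega)
      rw [h1, F.orbitPoint_apply, F.orbitPoint_apply]
      exact hc _ _ (Function.invFun_eq ⟨a, rfl⟩).symm _ (by omega) (by omega)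
  have h1 := hs.coverEntropyEntourage_le_log_card_div (Set.mapsTo_univ _ _) hn
  have h2 : SetRel.comp (F.agree W) (F.agree W) ⊆ F.agree W := by
    rintro ⟨x, z⟩ ⟨y, hxy, hyz⟩ j hj
    exact (hxy j hj).trans (hyz j hj)
  refine (Dynamics.coverEntropyEntourage_antitone _ _ h2).trans (h1.trans ?_)
  have h3 : ENNReal.log s.card ≤ (Real.log (Fintype.card ι) : EReal) := by
    have : (s.card : ENNReal) ≤ ENNReal.ofReal (Fintype.card ι : ℝ) := by
      rw [ENNReal.ofReal_natCast]
      exact_mod_cast Finset.card_image_le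
    refine (ENNReal.log_monotone this).trans ?_
    rw [ENNReal.log_ofReal_of_pos (by exact_mod_cast Fintype.card_pos)]
  rw [EReal.coe_div]
  exact EReal.monotone_div_right_of_nonneg (by positivity) h3

/-- Many distinct words of length `n` bound the entropy from below. -/
lemma card_le_netMaxcard {ι : Type*} [Fintype ι] (n : ℕ) (b : ι → ℤ)
    (hb : ∀ i i', (∀ j : ℕ, j < n → F.η (j + b i) = F.η (j + b i')) → i = i') :
    (Fintype.card ι : ℕ∞) ≤ Dynamics.netMaxcard F.T Set.univ (F.agree 0) n := by
  classical
  have hinj : Function.Injective fun i => F.orbitPoint (b i) := by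
    intro i i' h
    refine hb i i' fun j _ => ?_
    exact congrFun (congrArg Subtype.val h) j
  let s : Finset F.X := Finset.univ.image fun i : ι => F.orbitPoint (b i)
  have hs : Dynamics.IsDynNetIn F.T Set.univ (F.agree 0) n s := by
    refine ⟨Set.subset_univ _, ?_⟩
    intro x hx x' hx' hne
    obtain ⟨i, -, rfl⟩ := Finset.mem_image.1 (Finset.mem_coe.1 hx)
    obtain ⟨i', -, rfl⟩ := Finset.mem_image.1 (Finset.mem_coe.1 hx')
    refine Set.disjoint_left.2 fun y hy hy' => hne ?_
    have hy := (F.mem_dynEntourage_agree).1 hy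
    have hy' := (F.mem_dynEntourage_agree).1 hy'
    rw [hb i i' fun j hj => ?_]
    have h1 := hy j hj 0 (by simp)
    have h2 := hy' j hj 0 (by simp)
    simp only [F.orbitPoint_apply, zero_add] at h1 h2
    exact h1.trans h2.symm
  have := hs.card_le_netMaxcard
  rwa [Finset.card_image_of_injective _ hinj, Finset.card_univ] at this

end ToeplitzFlow

namespace HoleScheme

variable {L : ℕ} (H : HoleScheme L)

open Classical in
/-- The undetermined residues at stage `k`. -/
noncomputable def holes (k : ℕ) : Finset ℕ := {r ∈ Finset.range (H.p k) | (r : ℤ) ∈ H.U k}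

lemma mem_holes {k r : ℕ} : r ∈ H.holes k ↔ r < H.p k ∧ (r : ℤ) ∈ H.U k := by
  simp [holes]

variable [NeZero L]

lemma le_entropy (s : ℕ → Bool) (t : ℝ)
    (ht : ∀ k, t * H.p k ≤ (H.holes k).card * Real.log L) : (t : EReal) ≤ (H.flow s).entropy := by
  let F := H.flow s
  have hL : (0 : ℝ) < L := by exact_mod_cast Nat.pos_of_neZero L
  refine le_trans ?_ (Dynamics.netEntropyEntourage_le_coverEntropy (T := F.T) Set.univ
    (F.hasBasis_agree.mem_of_mem (i := 0) trivial))
  refine Frequently.le_expGrowthSup ?_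
  rw [Filter.frequently_atTop]
  intro N
  refine ⟨H.p N, (H.lt_p N).le, ?_⟩
  have h1 : (Fintype.card (H.holes N → Fin L) : ℕ∞) ≤
      Dynamics.netMaxcard F.T Set.univ (F.agree 0) (H.p N) := by
    have hex : ∀ g : H.holes N → Fin L, ∃ b : ℤ, ∀ r (hr : r ∈ H.holes N),
        H.bulk (b * H.p N + r) = g ⟨r, hr⟩ := by
      intro g
      classical
      obtain ⟨b, hb⟩ := H.exists_bulk_eq N fun r => if hr : r ∈ H.holes N then g ⟨r, hr⟩ else 0
      refine ⟨b, fun r hr => ?_⟩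
      have hr' := H.mem_holes.1 hr
      rw [hb r hr'.1 hr'.2, dif_pos hr]
    choose b hb using hex
    refine F.card_le_netMaxcard (H.p N) (fun g => b g * H.p N) fun g g' h => ?_
    funext ⟨r, hr⟩
    have h2 := congrArg Prod.fst (h r (H.mem_holes.1 hr).1)
    rw [← hb g r hr, ← hb g' r hr, add_comm, add_comm (b g' * _)]
    exact h2
  have h2 : (Fintype.card (H.holes N → Fin L) : ENNReal) =
      ENNReal.ofReal (L ^ (H.holes N).card) := by
    rw [Fintype.card_fun, Fintype.card_fin, Fintype.card_coe]
    rw [← ENNReal.ofReal_natCast]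
    push_cast
    rfl
  have h3 : EReal.exp ((t : EReal) * (H.p N : ℕ)) ≤
      (Fintype.card (H.holes N → Fin L) : ENNReal) := by
    rw [h2, ← EReal.coe_coe_eq_natCast, ← EReal.coe_mul, EReal.exp_coe]
    refine ENNReal.ofReal_le_ofReal ?_
    rw [← Real.le_log_iff_exp_le (by positivity), Real.log_pow]
    exact ht N
  exact h3.trans (by exact_mod_cast ENat.toENNReal_le.2 h1)

end HoleScheme

namespace HoleScheme

variable {L : ℕ} [NeZero L] (H : HoleScheme L)

/-- The phase modulo `p k`, together with the symbols in the holes of `N` consecutive blocks. -/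
noncomputable def code (s : ℕ → Bool) (k N : ℕ) (a : ℤ) :
    ZMod (H.p k) × (Fin N → (H.holes k → Fin L) × Bool × Bool) :=
  (a, fun i => (fun r => H.bulk ((a / H.p k - 1 + (i : ℕ)) * H.p k + (r : ℕ)),
    H.marker s ((a / H.p k - 1 + (i : ℕ)) * H.p k + H.z k)))

lemma seq_eq_of_code_eq (s : ℕ → Bool) (k m : ℕ) {a a' : ℤ}
    (h : H.code s k (m + 3) a = H.code s k (m + 3) a') {j : ℤ} (h0 : -(H.p k : ℤ) ≤ j)
    (h1 : j < m * H.p k + H.p k) : H.seq s (j + a) = H.seq s (j + a') := by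
  have hp : (0 : ℤ) < H.p k := by exact_mod_cast H.p_pos k
  simp only [code, Prod.mk.injEq] at h
  obtain ⟨h2, h3⟩ := h
  have hd : (H.p k : ℤ) ∣ a' - a := (ZMod.intCast_eq_intCast_iff_dvd_sub _ _ _).1 h2
  have hd' : (H.p k : ℤ) ∣ (j + a') - (j + a) := by simpa using hd
  have hmod : a' % H.p k = a % H.p k := (Int.modEq_iff_dvd.2 hd).symm
  have hr0 := Int.emod_nonneg (j + a) hp.ne'
  have hr1 := Int.emod_lt_of_pos (j + a) hp
  obtain ⟨r, hr⟩ := Int.eq_ofNat_of_zero_le hr0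
  have hb0 : a / H.p k - 1 ≤ (j + a) / H.p k := by
    rw [Int.le_ediv_iff_mul_le hp]
    have := Int.ediv_mul_le a hp.ne'
    linarith
  have hb1 : (j + a) / H.p k < a / H.p k - 1 + (m + 3) := by
    rw [Int.ediv_lt_iff_lt_mul hp]
    have := Int.lt_ediv_add_one_mul_self a hp
    linarith
  obtain ⟨i, hi⟩ := Int.eq_ofNat_of_zero_le (sub_nonneg.2 hb0)
  have hi' : i < m + 3 := by omega
  have e1 : j + a = (a / H.p k - 1 + i) * H.p k + r := by
    have := Int.ediv_mul_add_emod (j + a) (H.p k)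
    rw [hr] at this
    rw [← this, ← hi]; ring
  have e2 : j + a' = (a' / H.p k - 1 + i) * H.p k + r := by
    have h4 := Int.ediv_mul_add_emod a (H.p k)
    have h5 := Int.ediv_mul_add_emod a' (H.p k)
    rw [hmod] at h5
    linarith
  have h6 := congrFun h3 ⟨i, hi'⟩
  simp only [Prod.mk.injEq] at h6
  refine Prod.ext ?_ ?_
  · show H.bulk (j + a) = H.bulk (j + a')
    by_cases hU : j + a ∈ H.U k
    · have hrh : r ∈ H.holes k := by
        refine H.mem_holes.2 ⟨by omega, ?_⟩
        rw [e1, add_comm, H.U_periodic] at hU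
        exact hU
      rw [e1, e2]
      exact congrFun h6.1 ⟨r, hrh⟩
    · exact (H.bulk_congr hd' hU).symm
  · show H.marker s (j + a) = H.marker s (j + a')
    by_cases hM : j + a ∈ H.M k
    · have hrz : r = H.z k := by
        rw [e1] at hM
        have h7 : (H.p k : ℤ) ∣ r - H.z k := by
          have h8 : (H.p k : ℤ) ∣ (a / H.p k - 1 + i) * H.p k + r - H.z k := hM
          rw [add_sub_assoc] at h8
          exact (dvd_add_right (dvd_mul_left _ _)).1 h8
        have h9 := H.z_lt k
        obtain ⟨c, hc⟩ := h7
        have hc0 : c = 0 := by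
          by_contra hc0
          rcases lt_or_gt_of_ne hc0 with hc1 | hc1
          · nlinarith
          · nlinarith
        rw [hc0] at hc
        omega
      rw [e1, e2, hrz]
      exact h6.2
    · exact (H.marker_congr s hd' hM).symm

lemma coverEntropyEntourage_agree_le (s : ℕ → Bool) {t : ℝ} (h0 : 0 ≤ t)
    (ht : ∀ k, (H.holes k).card * Real.log L ≤ t * H.p k + Real.log L) {W k : ℕ}
    (hW : W ≤ H.p k) :
    Dynamics.coverEntropyEntourage (H.flow s).T Set.univ ((H.flow s).agree W) ≤
      ((t + (1 + 3 * t + 4 * (Real.log L + Real.log 4)) / H.p k : ℝ) : EReal) := by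
  have hp := H.p_pos k
  have : NeZero (H.p k) := ⟨hp.ne'⟩
  refine ((H.flow s).coverEntropyEntourage_agree_le W (n := H.p k * H.p k)
    (Nat.mul_pos hp hp).ne' (H.code s k (H.p k + 3)) fun a a' h j hj hj' =>
      H.seq_eq_of_code_eq s k _ h (by omega) (by push_cast at hj'; omega)).trans ?_
  rw [EReal.coe_le_coe_iff]
  have hL : (1 : ℝ) ≤ L := by exact_mod_cast Nat.pos_of_neZero L
  have hp' : (1 : ℝ) ≤ H.p k := by exact_mod_cast hp
  have hcard : (Fintype.card (ZMod (H.p k) ×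
      (Fin (H.p k + 3) → (H.holes k → Fin L) × Bool × Bool)) : ℝ) =
      H.p k * (L ^ (H.holes k).card * 4) ^ (H.p k + 3) := by
    simp only [Fintype.card_prod, ZMod.card, Fintype.card_fun, Fintype.card_fin, Fintype.card_coe,
      Fintype.card_bool]
    push_cast
    norm_num
  rw [hcard, Real.log_mul (by positivity) (by positivity), Real.log_pow,
    Real.log_mul (by positivity) (by norm_num), Real.log_pow]
  have h1 := ht k
  have h2 : Real.log (H.p k) ≤ H.p k := Real.log_le_self (by positivity)
  have h3 : 0 ≤ Real.log L := Real.log_nonneg hL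
  have h4 : 0 ≤ Real.log 4 := Real.log_nonneg (by norm_num)
  set P : ℝ := (H.p k : ℝ) with hP
  have h5 : ((H.p k + 3 : ℕ) : ℝ) = P + 3 := by push_cast; ring
  have h6 : ((H.p k * H.p k : ℕ) : ℝ) = P * P := by push_cast; rfl
  rw [h5, h6]
  have h7 : t + (1 + 3 * t + 4 * (Real.log L + Real.log 4)) / P =
      ((t * P + (1 + 3 * t + 4 * (Real.log L + Real.log 4))) * P) / (P * P) := by
    field_simp
  rw [h7]
  refine div_le_div_of_nonneg_right ?_ (by positivity)
  have h8 : (P + 3) * ((H.holes k).card * Real.log L + Real.log 4) ≤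
      (P + 3) * (t * P + (Real.log L + Real.log 4)) :=
    mul_le_mul_of_nonneg_left (by linarith) (by positivity)
  nlinarith

lemma entropy_le (s : ℕ → Bool) {t : ℝ} (h0 : 0 ≤ t)
    (ht : ∀ k, (H.holes k).card * Real.log L ≤ t * H.p k + Real.log L) :
    (H.flow s).entropy ≤ (t : EReal) := by
  have hL : (1 : ℝ) ≤ L := by exact_mod_cast Nat.pos_of_neZero L
  rw [ToeplitzFlow.entropy, Dynamics.coverEntropy_eq_iSup_basis (H.flow s).hasBasis_agree]
  refine iSup₂_le fun W _ => EReal.le_of_forall_lt_iff_le.1 fun b hb => ?_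
  have hb : t < b := by exact_mod_cast hb
  set C := 1 + 3 * t + 4 * (Real.log L + Real.log 4) with hC
  have hC0 : 0 ≤ C := by
    have h3 : 0 ≤ Real.log L := Real.log_nonneg hL
    have h4 : 0 ≤ Real.log 4 := Real.log_nonneg (by norm_num)
    positivity
  obtain ⟨k, hk⟩ := exists_nat_gt (max (W : ℝ) (C / (b - t)))
  have hkp : (k : ℝ) < H.p k := by exact_mod_cast H.lt_p k
  have hWk : W ≤ H.p k := by exact_mod_cast ((le_max_left _ _).trans_lt (hk.trans hkp)).le
  refine (H.coverEntropyEntourage_agree_le s h0 ht hWk).trans ?_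
  rw [EReal.coe_le_coe_iff, ← hC]
  have h5 := (le_max_right _ _).trans_lt (hk.trans hkp)
  have hp : (0 : ℝ) < H.p k := by exact_mod_cast H.p_pos k
  have h6 : C / H.p k ≤ b - t := by
    rw [div_lt_iff₀ (by linarith)] at h5
    rw [div_le_iff₀ hp]
    linarith
  linarith

end HoleScheme

/-- The number of holes at a stage of period `p`, for hole density `d`. -/
noncomputable def holeCount (d : ℝ) (p : ℕ) : ℕ := ⌊d * p⌋₊ + 1

/-- The residues that may stay undetermined when passing from period `p` to period `p * q`. -/
def refinedHoles (L p q : ℕ) (D : Finset ℕ) : Finset ℕ :=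
  {n ∈ Finset.range (p * q) | n % p ∈ D ∧ L ^ p ≤ n / p ∧ n / p + 1 < q}

lemma card_mul_le_card_refinedHoles {L p q : ℕ} {D : Finset ℕ} (hD : D ⊆ Finset.range p) :
    D.card * (q - 1 - L ^ p) ≤ (refinedHoles L p q D).card := by
  rw [← Nat.card_Ico, ← Finset.card_product]
  refine Finset.card_le_card_of_injOn (fun x => x.1 + p * x.2) ?_ ?_
  · rintro ⟨r, b⟩ h
    simp only [Finset.coe_product, Set.mem_prod, Finset.mem_coe, Finset.mem_Ico] at h
    have hr := Finset.mem_range.1 (hD h.1)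
    have hp : 0 < p := by omega
    have h1 : (r + p * b) % p = r := by rw [Nat.add_mul_mod_self_left, Nat.mod_eq_of_lt hr]
    have h2 : (r + p * b) / p = b := by
      rw [Nat.add_mul_div_left _ _ hp, Nat.div_eq_of_lt hr, zero_add]
    simp only [refinedHoles, Finset.coe_filter, Set.mem_ofPred_eq, Finset.mem_range, h1, h2]
    refine ⟨?_, h.1, h.2.1, by omega⟩
    calc r + p * b < p * (b + 1) := by rw [mul_add]; omega
      _ ≤ p * q := Nat.mul_le_mul_left _ (by omega)
  · rintro ⟨r, b⟩ h ⟨r', b'⟩ h' heq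
    simp only [Finset.coe_product, Set.mem_prod, Finset.mem_coe, Finset.mem_Ico] at h h'
    have hr := Finset.mem_range.1 (hD h.1)
    have hr' := Finset.mem_range.1 (hD h'.1)
    have hp : 0 < p := by omega
    simp only at heq
    have h1 := congrArg (· % p) heq
    have h2 := congrArg (· / p) heq
    simp only [Nat.add_mul_mod_self_left, Nat.mod_eq_of_lt hr, Nat.mod_eq_of_lt hr',
      Nat.add_mul_div_left _ _ hp, Nat.div_eq_of_lt hr, Nat.div_eq_of_lt hr', zero_add] at h1 h2
    rw [h1, h2]

lemma exists_refinement (L : ℕ) (d : ℝ) (hd : 0 ≤ d) (p : ℕ) (D : Finset ℕ)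
    (hD : D ⊆ Finset.range p) (hc : D.card = holeCount d p) :
    ∃ G : ℕ, ∀ q ≥ G, L ^ p + 4 ≤ q ∧
      ∃ D' ⊆ refinedHoles L p q D, D'.card = holeCount d (p * q) := by
  set δ : ℝ := holeCount d p - d * p with hδ
  have hδ0 : 0 < δ := by
    have := Nat.lt_floor_add_one (d * p)
    simp only [hδ, holeCount]
    push_cast
    linarith
  obtain ⟨G, hG⟩ := exists_nat_ge ((1 + holeCount d p * (1 + L ^ p : ℝ)) / δ)
  refine ⟨max G (L ^ p + 4), fun q hq => ?_⟩
  have hq1 : L ^ p + 4 ≤ q := (le_max_right _ _).trans hq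
  refine ⟨hq1, ?_⟩
  have hqG : (G : ℝ) ≤ q := by exact_mod_cast (le_max_left _ _).trans hq
  refine Finset.exists_subset_card_eq (le_trans ?_ (card_mul_le_card_refinedHoles hD))
  have h1 : (holeCount d (p * q) : ℝ) ≤ d * (p * q) + 1 := by
    have := Nat.floor_le (show 0 ≤ d * ((p * q : ℕ) : ℝ) by positivity)
    simp only [holeCount]
    push_cast at this ⊢
    linarith
  have h2 : ((q - 1 - L ^ p : ℕ) : ℝ) = q - 1 - L ^ p := by
    rw [Nat.cast_sub (by omega), Nat.cast_sub (by omega)]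
    push_cast
    ring
  have h3 : (1 + holeCount d p * (1 + L ^ p : ℝ)) ≤ q * δ := by
    rw [div_le_iff₀ hδ0] at hG
    exact hG.trans (mul_le_mul_of_nonneg_right hqG hδ0.le)
  rw [hc, ← Nat.cast_le (α := ℝ), Nat.cast_mul, h2]
  refine h1.trans ?_
  rw [hδ] at h3
  nlinarith

lemma exists_holeScheme (L : ℕ) (d : ℝ) (hd : 0 ≤ d) (hd1 : d < 1) (a : ℕ → ℕ)
    (ha : ∀ n, 2 ≤ a n) :
    ∃ (H : HoleScheme L) (κ : ℕ → ℕ), StrictMono κ ∧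
      (∀ k, H.p k = ∏ i ∈ Finset.range (κ k), a i) ∧
      ∀ k, (H.holes k).card = holeCount d (H.p k) := by
  let P : ℕ → ℕ := fun K => ∏ i ∈ Finset.range K, a i
  have hP : ∀ K, 0 < P K := fun K => Finset.prod_pos fun i _ => two_pos.trans_le (ha i)
  let S := {x : ℕ × Finset ℕ // x.2 ⊆ Finset.range (P x.1) ∧ x.2.card = holeCount d (P x.1)}
  have hstep : ∀ x : S, ∃ (y : S) (q : ℕ), x.1.1 < y.1.1 ∧ P y.1.1 = P x.1.1 * q ∧
      L ^ P x.1.1 + 4 ≤ q ∧ y.1.2 ⊆ refinedHoles L (P x.1.1) q x.1.2 := by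
    rintro ⟨⟨K, D⟩, hD, hc⟩
    obtain ⟨G, hG⟩ := exists_refinement L d hd (P K) D hD hc
    set q := ∏ i ∈ Finset.range (G + 1), a (K + i) with hq
    have hGq : G ≤ q := by
      have h1 : 2 ^ (G + 1) ≤ q := by
        have := Finset.pow_card_le_prod (Finset.range (G + 1)) (fun i => a (K + i)) 2
          fun i _ => ha _
        simpa using this
      exact (Nat.lt_two_pow_self.le.trans (Nat.pow_le_pow_right two_pos G.le_succ)).trans h1
    have hPq : P (K + (G + 1)) = P K * q := Finset.prod_range_add _ _ _
    obtain ⟨h4, D', hD', hc'⟩ := hG q hGq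
    refine ⟨⟨⟨K + (G + 1), D'⟩, ?_, ?_⟩, q, ?_, hPq, h4, hD'⟩
    · rw [hPq]
      exact hD'.trans (Finset.filter_subset _ _)
    · rw [hPq]; exact hc'
    · simp
  choose next quo hlt hmul hquo hsub using hstep
  have hx₀ : holeCount d (P 0) = 1 := by
    have : ⌊d⌋₊ = 0 := Nat.floor_eq_zero.2 hd1
    simp [holeCount, P, this]
  let x₀ : S := ⟨⟨0, {0}⟩, by simp [P], by simp [hx₀]⟩
  let σ : ℕ → S := fun k => Nat.rec x₀ (fun _ x => next x) k
  have hσ : ∀ k, σ (k + 1) = next (σ k) := fun k => rfl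
  have hp0 : ∀ k, (P (σ k).1.1 : ℤ) ≠ 0 := fun k => by exact_mod_cast (hP _).ne'
  let H : HoleScheme L :=
    { p := fun k => P (σ k).1.1
      q := fun k => quo (σ k)
      U := fun k => {n | (n % P (σ k).1.1).toNat ∈ (σ k).1.2}
      p_zero := by simp [σ, x₀, P]
      p_succ := fun k => hmul (σ k)
      le_q := fun k => hquo (σ k)
      U_zero := by
        ext n
        simp [σ, x₀, P]
      U_periodic := fun k n m => by
        simp
      U_succ := fun k n hn => by
        have h1 : (n % P (σ (k + 1)).1.1).toNat ∈ (σ (k + 1)).1.2 := hn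
        have h2 := hsub (σ k) h1
        rw [hσ, hmul] at h2
        set p := P (σ k).1.1 with hp
        set q := quo (σ k) with hq
        have hppos : (0 : ℤ) < p := by exact_mod_cast hP _
        have hqpos : (0 : ℤ) < q := by have := hquo (σ k); omega
        obtain ⟨r, hr⟩ := Int.eq_ofNat_of_zero_le
          (Int.emod_nonneg n (show ((p * q : ℕ) : ℤ) ≠ 0 by push_cast; positivity))
        rw [hr] at h2
        simp only [Int.toNat_natCast, refinedHoles, Finset.mem_filter] at h2
        obtain ⟨-, h3, h4, h5⟩ := h2
        have h6 : n = r + p * (q * (n / ((p * q : ℕ) : ℤ))) := by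
          have := Int.emod_add_mul_ediv n ((p * q : ℕ) : ℤ)
          rw [hr] at this
          push_cast at this ⊢
          linarith
        have h7 : n % p = ((r % p : ℕ) : ℤ) := by
          rw [h6, Int.add_mul_emod_self_left]; rfl
        have h8 : n / p % q = ((r / p : ℕ) : ℤ) := by
          rw [h6, Int.add_mul_ediv_left _ _ hppos.ne', Int.add_mul_emod_self_left,
            ← Int.natCast_div, Int.emod_eq_of_lt (by omega) (by omega)]
        refine ⟨?_, ?_, ?_⟩
        · show (n % p).toNat ∈ (σ k).1.2
          rw [h7, Int.toNat_natCast]; exact h3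
        · rw [h8]; exact_mod_cast h4
        · rw [h8]; exact_mod_cast h5 }
  refine ⟨H, fun k => (σ k).1.1, strictMono_nat_of_lt_succ fun k => hlt (σ k),
    fun k => rfl, fun k => ?_⟩
  rw [← (σ k).2.2]
  congr 1
  ext r
  rw [HoleScheme.mem_holes]
  have hmem : r < P (σ k).1.1 → ((r : ℤ) ∈ H.U k ↔ r ∈ (σ k).1.2) := fun h => by
    show ((r : ℤ) % (P (σ k).1.1 : ℕ)).toNat ∈ (σ k).1.2 ↔ _
    rw [Int.emod_eq_of_lt (by omega) (by omega), Int.toNat_natCast]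
  constructor
  · exact fun h => (hmem h.1).1 h.2
  · intro h
    have := Finset.mem_range.1 ((σ k).2.1 h)
    exact ⟨this, (hmem this).2 h⟩

namespace HoleScheme

variable {L : ℕ} [NeZero L] (H : HoleScheme L)

lemma eigenvalues_eq (s : ℕ → Bool) {a : ℕ → ℕ} {κ : ℕ → ℕ} (hκ : StrictMono κ)
    (hp : ∀ k, H.p k = ∏ i ∈ Finset.range (κ k), a i) :
    {lam : ℂ | ∃ f : C((H.flow s).X, ℂ), f ≠ 0 ∧
        ∀ x : (H.flow s).X, f ((H.flow s).T x) = lam * f x} =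
      {z : ℂ | ∃ (m : ℤ) (k : ℕ),
        z = Complex.exp (2 * Real.pi * Complex.I * m /
          (∏ n ∈ Finset.range (k + 1), (a n : ℂ)))} := by
  have hprod : ∀ {K k}, κ k ≤ K → ∏ i ∈ Finset.range K, (a i : ℂ) =
      H.p k * (∏ i ∈ Finset.range (K - κ k), a (κ k + i) : ℕ) := by
    intro K k hK
    obtain ⟨j, rfl⟩ := Nat.exists_eq_add_of_le hK
    rw [hp, Finset.prod_range_add]
    push_cast
    simp
  have hP : ∀ K, (∏ i ∈ Finset.range K, (a i : ℂ)) ≠ 0 := by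
    intro K
    have h1 := (H.p_pos K).ne'
    rw [hp, Finset.prod_ne_zero_iff] at h1
    refine Finset.prod_ne_zero_iff.2 fun i hi => Nat.cast_ne_zero.2 (h1 i ?_)
    exact Finset.mem_range.2 ((Finset.mem_range.1 hi).trans_le (hκ.id_le K))
  have hpc : ∀ k, ∏ i ∈ Finset.range (κ k), (a i : ℂ) = H.p k := fun k => by
    rw [hp]; push_cast; rfl
  ext z
  simp only [Set.mem_ofPred_eq]
  constructor
  · rintro ⟨f, hf, h⟩
    obtain ⟨m, k, rfl⟩ := H.exists_eq_exp_of_eigenfunction s f hf h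
    have hm : κ k ≤ κ k + 1 := Nat.le_succ _
    have h1 := hP (κ k + 1)
    rw [hprod hm] at h1
    refine ⟨m * (∏ i ∈ Finset.range (κ k + 1 - κ k), a (κ k + i) : ℕ), κ k, ?_⟩
    rw [hprod hm]
    congr 1
    push_cast at h1 ⊢
    have h2 := left_ne_zero_of_mul h1
    have h3 := right_ne_zero_of_mul h1
    field_simp
  · rintro ⟨m, k, rfl⟩
    have hm : k + 1 ≤ κ (k + 1) := hκ.id_le _
    obtain ⟨j, hj⟩ := Nat.exists_eq_add_of_le hm
    have h1 : (H.p (k + 1) : ℂ) = (∏ n ∈ Finset.range (k + 1), (a n : ℂ)) *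
        (∏ i ∈ Finset.range j, a (k + 1 + i) : ℕ) := by
      rw [← hpc, hj, Finset.prod_range_add]
      push_cast
      rfl
    obtain ⟨f, hf, h⟩ := H.exists_eigenfunction s
      (m * (∏ i ∈ Finset.range j, a (k + 1 + i) : ℕ)) (k + 1)
    refine ⟨f, hf, fun x => ?_⟩
    rw [h x]
    congr 2
    have h4 : (H.p (k + 1) : ℂ) ≠ 0 := by exact_mod_cast (H.p_pos _).ne'
    rw [h1] at h4 ⊢
    have h2 := left_ne_zero_of_mul h4
    have h3 := right_ne_zero_of_mul h4
    push_cast at h3 ⊢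
    field_simp

lemma entropy_eq (s : ℕ → Bool) {t : ℝ} (ht : 0 ≤ t) (hL : 0 < Real.log L)
    (hc : ∀ k, (H.holes k).card = holeCount (t / Real.log L) (H.p k)) :
    (H.flow s).entropy = (t : EReal) := by
  refine le_antisymm (H.entropy_le s ht fun k => ?_) (H.le_entropy s t fun k => ?_)
  · have h1 := Nat.floor_le (show 0 ≤ t / Real.log L * (H.p k : ℝ) by positivity)
    rw [hc, holeCount, Nat.cast_add_one, add_mul, one_mul]
    refine add_le_add_left ?_ _
    calc _ ≤ t / Real.log L * (H.p k : ℝ) * Real.log L := by gcongr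
      _ = t * H.p k := by field_simp
  · have h1 := (Nat.lt_floor_add_one (t / Real.log L * (H.p k : ℝ))).le
    rw [hc, holeCount, Nat.cast_add_one]
    calc t * H.p k = t / Real.log L * (H.p k : ℝ) * Real.log L := by field_simp
      _ ≤ _ := by gcongr

lemma not_countable_range_cohomologicalAverages :
    ¬ (Set.range fun s : ℕ → Bool => cohomologicalAverages (H.flow s).T).Countable := by
  intro h
  have h1 : (⋃₀ Set.range fun s : ℕ → Bool => cohomologicalAverages (H.flow s).T).Countable :=
    h.sUnion (by rintro _ ⟨s, rfl⟩; exact (H.flow s).countable_cohomologicalAverages_T)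
  have h2 : (Set.range H.freq).Countable := h1.mono (by
    rintro _ ⟨s, rfl⟩
    exact ⟨_, ⟨s, rfl⟩, H.freq_mem_cohomologicalAverages s⟩)
  have h3 : Countable (ℕ → Bool) := by
    rw [← Set.countable_univ_iff]
    refine Set.countable_of_injective_of_countable_image (f := H.freq) H.freq_injective.injOn ?_
    rwa [Set.image_univ]
  obtain ⟨φ, hφ⟩ := exists_surjective_nat (ℕ → Bool)
  obtain ⟨n, hn⟩ := hφ fun n => !φ n n
  simpa using congrFun hn n

end HoleScheme

/-- for every `t ∈ [0, ∞)` and every sequence `a` with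
`a n ≥ 2`, there is an uncountable family of pairwise non-strong-orbit-
equivalent Toeplitz flows of entropy `t` whose set of continuous eigenvalues
is exactly `{e^{2πim/(a 0 ⋯ a k)} : m ∈ ℤ, k ∈ ℕ}` (i.e. whose maximal
equicontinuous factor is the odometer of `a`). -/
theorem uncountably_many_non_strong_orbit_equivalent_toeplitz_flows
    (t : ℝ) (ht : 0 ≤ t)
    (a : ℕ → ℕ) (ha : ∀ n, 2 ≤ a n) :
    ∃ (I : Type) (Fam : I → ToeplitzFlow),
      ¬ Countable I ∧
      (∀ i : I, (Fam i).entropy = (t : EReal)) ∧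
      (∀ i : I,
        {lam : ℂ | ∃ f : C((Fam i).X, ℂ), f ≠ 0 ∧
            ∀ x : (Fam i).X, f ((Fam i).T x) = lam * f x} =
          {z : ℂ | ∃ (m : ℤ) (k : ℕ),
            z = Complex.exp (2 * Real.pi * Complex.I * m /
              (∏ n ∈ Finset.range (k + 1), (a n : ℂ)))}) ∧
      (∀ i j : I, i ≠ j → ¬ StrongOrbitEquiv (Fam i).T (Fam j).T) := by
  obtain ⟨L, hL⟩ := exists_nat_gt (Real.exp t)
  have hL0 : (0 : ℝ) < L := (Real.exp_pos t).trans hL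
  have hlog : t < Real.log L := (Real.lt_log_iff_exp_lt hL0).2 hL
  have : NeZero L := ⟨by rintro rfl; simp at hL0⟩
  obtain ⟨H, κ, hκ, hp, hc⟩ := exists_holeScheme L (t / Real.log L)
    (div_nonneg ht (ht.trans hlog.le)) ((div_lt_one (ht.trans_lt hlog)).2 hlog) a ha
  let I := Set.range fun s : ℕ → Bool => cohomologicalAverages (H.flow s).T
  choose σ hσ using fun i : I => i.2
  refine ⟨I, fun i => H.flow (σ i), ?_, fun i => H.entropy_eq _ ht (ht.trans_lt hlog) hc,
    fun i => H.eigenvalues_eq _ hκ hp, fun i j hij h => hij (Subtype.ext ?_)⟩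
  · exact fun h => H.not_countable_range_cohomologicalAverages (Set.countable_coe_iff.1 h)
  · rw [← hσ i, ← hσ j]
    exact h.cohomologicalAverages_eq
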